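/- Let G be a finite group, let H be a nontrivial subgroup of G, and let x ∈ G. Suppose that HxH ≠ Hx⁻¹H and |HxH|/|H| equals 1 or 2. Then there exist |H| pairwise disjoint inverse-closed right transversals of H in HxH ∪ Hx⁻¹H. In particular, for any integer b with 0 ≤ b ≤ |H|, there exist b pairwise disjoint right transversals of H in HxH ∪ Hx⁻¹H whose union is inverse-closed. -/

import Mathlib

open scoped Pointwise

/-- The double coset `HxH = {h₁ * x * h₂ : h₁, h₂ ∈ H}`. -/
def doubleCoset {G : Type*} [Group G] (H : Subgroup G) (x : G) : Set G :=
  (H : Set G) * {x} * (H : Set G)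

/-- For a subset `K` of `G` that is a union of right cosets of `H`, a right transversal of
`H` in `K` is a subset `T` of `K` containing exactly one element from each right coset of
`H` contained in `K`. -/
def IsRightTransversalIn {G : Type*} [Group G] (H : Subgroup G) (K T : Set G) : Prop :=
  T ⊆ K ∧ ∀ x ∈ K, ∃! t, t ∈ T ∧ t * x⁻¹ ∈ H

theorem aux_color {D A B : Type*} [Finite D] [Finite A] [Finite B] [Nonempty A] [Nonempty B]
    (f : D → A) (g : D → B) (m N : ℕ) (hN : 0 < N)
    (hm : ∀ a b, Nat.card {d // f d = a ∧ g d = b} = m)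
    (hf : ∀ a, Nat.card {d // f d = a} = N) (hg : ∀ b, Nat.card {d // g d = b} = N) :
    ∃ c : D → Fin N, (∀ a k, ∃! d, f d = a ∧ c d = k) ∧ (∀ b k, ∃! d, g d = b ∧ c d = k) := by
  classical
  have e0 : ∀ a b, Nonempty ({d // f d = a ∧ g d = b} ≃ Fin m) := fun a b =>
    ⟨Finite.equivFinOfCardEq (hm a b)⟩
  let e := fun a b => Classical.choice (e0 a b)
  have hB : Nat.card B * m = N := by
    obtain ⟨a⟩ := ‹Nonempty A›
    rw [← hf a]
    have : Nat.card (B × Fin m) = Nat.card B * m := by simp [Nat.card_prod]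
    rw [← this]
    refine Nat.card_congr (Equiv.symm ?_)
    refine Equiv.ofBijective (fun d => (g d.1, e a (g d.1) ⟨d.1, d.2, rfl⟩)) ⟨?_, ?_⟩
    · rintro ⟨d, hd⟩ ⟨d', hd'⟩ h
      simp only [Prod.mk.injEq] at h
      obtain ⟨h1, h2⟩ := h
      have : ∀ b b' (hb : g d = b) (hb2 : g d' = b') (_ : b = b'),
        e a b ⟨d, hd, hb⟩ = e a b' ⟨d', hd', hb2⟩ → d = d' := by
        rintro b _ hb hb2 rfl h
        simpa using (e a b).injective h
      exact Subtype.ext (this _ _ rfl rfl h1 h2)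
    · rintro ⟨b, k⟩
      obtain ⟨⟨d, h1, h2⟩, h3⟩ := (e a b).surjective k
      subst h2
      exact ⟨⟨d, h1⟩, by simp [h3]⟩
  have hA : Nat.card A * m = N := by
    obtain ⟨b⟩ := ‹Nonempty B›
    rw [← hg b]
    have : Nat.card (A × Fin m) = Nat.card A * m := by simp [Nat.card_prod]
    rw [← this]
    refine Nat.card_congr (Equiv.symm ?_)
    refine Equiv.ofBijective (fun d => (f d.1, e (f d.1) b ⟨d.1, rfl, d.2⟩)) ⟨?_, ?_⟩
    · rintro ⟨d, hd⟩ ⟨d', hd'⟩ h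
      simp only [Prod.mk.injEq] at h
      obtain ⟨h1, h2⟩ := h
      have : ∀ a a' (hb : f d = a) (hb2 : f d' = a') (_ : a = a'),
        e a b ⟨d, hb, hd⟩ = e a' b ⟨d', hb2, hd'⟩ → d = d' := by
        rintro a _ hb hb2 rfl h
        simpa using (e a b).injective h
      exact Subtype.ext (this _ _ rfl rfl h1 h2)
    · rintro ⟨a, k⟩
      obtain ⟨⟨d, h1, h2⟩, h3⟩ := (e a b).surjective k
      subst h1
      exact ⟨⟨d, h2⟩, by simp [h3]⟩
  have hm0 : 0 < m := Nat.pos_of_ne_zero (by rintro rfl; omega)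
  have hAB : Nat.card A = Nat.card B := Nat.eq_of_mul_eq_mul_right hm0 (hA.trans hB.symm)
  set n := Nat.card A with hn
  have : NeZero n := ⟨Nat.card_pos.ne'⟩
  let eA : A ≃ ZMod n := (Finite.equivFinOfCardEq hn.symm).trans (ZMod.finEquiv n).toEquiv
  let eB : B ≃ ZMod n := (Finite.equivFinOfCardEq hAB.symm).trans (ZMod.finEquiv n).toEquiv
  let eN : ZMod n × Fin m ≃ Fin N := Finite.equivFinOfCardEq (by simp [Nat.card_prod, hA])
  let c : D → Fin N := fun d => eN (eA (f d) + eB (g d), e (f d) (g d) ⟨d, rfl, rfl⟩)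
  have key : ∀ a b d, f d = a → g d = b → ∀ s k, (c d = eN (s, k) ↔
      eA a + eB b = s ∧ d = ((e a b).symm k).1) := by
    rintro a b d rfl rfl s k
    simp only [c, eN.apply_eq_iff_eq, Prod.mk.injEq]
    refine and_congr_right fun _ => ?_
    rw [← Equiv.eq_symm_apply, Subtype.ext_iff]
  refine ⟨c, ?_, ?_⟩
  · intro a k
    obtain ⟨⟨s, k⟩, rfl⟩ := eN.surjective k
    set b := eB.symm (s - eA a) with hb
    have hp := ((e a b).symm k).2
    refine ⟨((e a b).symm k).1, ⟨hp.1, (key a b _ hp.1 hp.2 _ _).2 ⟨by simp [hb], rfl⟩⟩, ?_⟩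
    rintro d ⟨h1, h2⟩
    have h3 := (key a (g d) d h1 rfl _ _).1 h2
    have h4 : g d = b := by
      rw [hb, Equiv.eq_symm_apply, ← h3.1]; ring
    rw [h4] at h3
    exact h3.2
  · intro b k
    obtain ⟨⟨s, k⟩, rfl⟩ := eN.surjective k
    set a := eA.symm (s - eB b) with ha
    have hp := ((e a b).symm k).2
    refine ⟨((e a b).symm k).1, ⟨hp.2, (key a b _ hp.1 hp.2 _ _).2 ⟨by simp [ha], rfl⟩⟩, ?_⟩
    rintro d ⟨h1, h2⟩
    have h3 := (key (f d) b d rfl h1 _ _).1 h2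
    have h4 : f d = a := by
      rw [ha, Equiv.eq_symm_apply, ← h3.1]; ring
    rw [h4] at h3
    exact h3.2

theorem aux_mem {G : Type*} [Group G] (H : Subgroup G) (x y : G) :
    y ∈ doubleCoset H x ↔ ∃ a ∈ H, ∃ b ∈ H, y = a * x * b :=
  DoubleCoset.mem_doubleCoset

theorem aux_left {G : Type*} [Group G] (H : Subgroup G) {x y t : G}
    (hy : y ∈ doubleCoset H x) (h : t * y⁻¹ ∈ H) : t ∈ doubleCoset H x := by
  rw [aux_mem] at *
  obtain ⟨a, ha, b, hb, rfl⟩ := hy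
  exact ⟨_, H.mul_mem h ha, b, hb, by group⟩

theorem aux_right {G : Type*} [Group G] (H : Subgroup G) {x y t : G}
    (hy : y ∈ doubleCoset H x) (h : t⁻¹ * y ∈ H) : t ∈ doubleCoset H x := by
  rw [aux_mem] at *
  obtain ⟨a, ha, b, hb, rfl⟩ := hy
  exact ⟨a, ha, _, H.mul_mem hb (H.inv_mem h), by group⟩

theorem aux_inv {G : Type*} [Group G] (H : Subgroup G) {x y : G} :
    y ∈ doubleCoset H x⁻¹ ↔ y⁻¹ ∈ doubleCoset H x := by
  rw [aux_mem, aux_mem]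
  constructor
  · rintro ⟨a, ha, b, hb, rfl⟩
    exact ⟨_, H.inv_mem hb, _, H.inv_mem ha, by group⟩
  · rintro ⟨a, ha, b, hb, h⟩
    refine ⟨_, H.inv_mem hb, _, H.inv_mem ha, ?_⟩
    rw [← inv_inv y, h]; group

theorem aux_mid {G : Type*} [Group G] [Finite G] (H : Subgroup G) (x : G) :
    ∃ c : G → Fin (Nat.card H),
      (∀ y ∈ doubleCoset H x, ∀ k, ∃! t, t * y⁻¹ ∈ H ∧ c t = k) ∧
      (∀ y ∈ doubleCoset H x, ∀ k, ∃! t, t⁻¹ * y ∈ H ∧ c t = k) := by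
  classical
  let F : doubleCoset H x → Quotient (QuotientGroup.rightRel H) := fun d => Quotient.mk'' d.1
  let L : doubleCoset H x → Quotient (QuotientGroup.leftRel H) := fun d => Quotient.mk'' d.1
  have hF : ∀ t d, F t = F d ↔ t.1 * d.1⁻¹ ∈ H := by
    intro t d
    rw [eq_comm]
    simp only [F, Quotient.eq'', QuotientGroup.rightRel_apply]
  have hL : ∀ t d, L t = L d ↔ t.1⁻¹ * d.1 ∈ H := by
    intro t d
    simp only [L, Quotient.eq'', QuotientGroup.leftRel_apply]
  have hF' : ∀ t d, Set.rangeFactorization F t = Set.rangeFactorization F d ↔ t.1 * d.1⁻¹ ∈ H := fun t d =>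
    Subtype.ext_iff.trans (hF t d)
  have hL' : ∀ t d, Set.rangeFactorization L t = Set.rangeFactorization L d ↔ t.1⁻¹ * d.1 ∈ H := fun t d =>
    Subtype.ext_iff.trans (hL t d)
  have hx : x ∈ doubleCoset H x := (aux_mem _ _ _).2 ⟨1, H.one_mem, 1, H.one_mem, by simp⟩
  have : Nonempty (doubleCoset H x) := ⟨⟨x, hx⟩⟩
  refine Exists.elim (aux_color (Set.rangeFactorization F) (Set.rangeFactorization L)
    (Nat.card {w : G // w * x⁻¹ ∈ H ∧ w⁻¹ * x ∈ H}) (Nat.card H) Nat.card_pos ?_ ?_ ?_) ?_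
  rotate_left 3
  · rintro c ⟨hc1, hc2⟩
    have : Nonempty (Fin (Nat.card H)) := ⟨⟨0, Nat.card_pos⟩⟩
    let k0 : Fin (Nat.card H) := Classical.choice this
    refine ⟨fun t => if h : t ∈ doubleCoset H x then c ⟨t, h⟩ else k0, ?_, ?_⟩
    · intro y hy k
      obtain ⟨t, ⟨h1, h2⟩, h3⟩ := hc1 ⟨F ⟨y, hy⟩, _, rfl⟩ k
      have h1' := (hF _ _).1 (congrArg Subtype.val h1)
      refine ⟨t.1, ⟨h1', by simp [h2]⟩, ?_⟩
      rintro s ⟨hs1, hs2⟩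
      have hs := aux_left H hy hs1
      simp only [hs, dif_pos] at hs2
      exact congrArg Subtype.val (h3 ⟨s, hs⟩ ⟨Subtype.ext ((hF _ _).2 hs1), hs2⟩)
    · intro y hy k
      obtain ⟨t, ⟨h1, h2⟩, h3⟩ := hc2 ⟨L ⟨y, hy⟩, _, rfl⟩ k
      have h1' := (hL _ _).1 (congrArg Subtype.val h1)
      refine ⟨t.1, ⟨h1', by simp [h2]⟩, ?_⟩
      rintro s ⟨hs1, hs2⟩
      have hs := aux_right H hy hs1
      simp only [hs, dif_pos] at hs2
      exact congrArg Subtype.val (h3 ⟨s, hs⟩ ⟨Subtype.ext ((hL _ _).2 hs1), hs2⟩)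
  · intro y z
    obtain ⟨y, rfl⟩ := Set.rangeFactorization_surjective (f := F) y
    obtain ⟨z, rfl⟩ := Set.rangeFactorization_surjective (f := L) z
    obtain ⟨y, hy⟩ := y
    obtain ⟨z, hz⟩ := z
    simp only [hF', hL']
    obtain ⟨a, ha, b, hb, rfl⟩ := (aux_mem _ _ _).1 hy
    obtain ⟨a', ha', b', hb', rfl⟩ := (aux_mem _ _ _).1 hz
    refine Nat.card_congr ?_
    refine
      { toFun := fun d => ⟨a'⁻¹ * d.1.1 * b⁻¹, ?_, ?_⟩
        invFun := fun w => ⟨⟨a' * w.1 * b, ?_⟩, ?_, ?_⟩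
        left_inv := fun d => by ext; simp [mul_assoc]
        right_inv := fun d => by ext; simp [mul_assoc] }
    · have := H.mul_mem (H.mul_mem (H.inv_mem ha') d.2.1) ha
      convert this using 1; group
    · have := H.mul_mem (H.mul_mem hb d.2.2) (H.inv_mem hb')
      convert this using 1; group
    · rw [aux_mem]
      exact ⟨_, H.mul_mem ha' w.2.1, b, hb, by group⟩
    · have := H.mul_mem (H.mul_mem ha' w.2.1) (H.inv_mem ha)
      convert this using 1; group
    · have := H.mul_mem (H.mul_mem (H.inv_mem hb) w.2.2) hb'
      convert this using 1; group
  · intro y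
    obtain ⟨y, rfl⟩ := Set.rangeFactorization_surjective (f := F) y
    obtain ⟨y, hy⟩ := y
    simp only [hF']
    refine Nat.card_congr ?_
    exact
      { toFun := fun d => ⟨_, d.2⟩
        invFun := fun h => ⟨⟨h.1 * y, aux_left H hy (by simp)⟩, by simp⟩
        left_inv := fun d => by ext; simp
        right_inv := fun d => by ext; simp }
  · intro y
    obtain ⟨y, rfl⟩ := Set.rangeFactorization_surjective (f := L) y
    obtain ⟨y, hy⟩ := y
    simp only [hL']
    refine Nat.card_congr ?_
    exact
      { toFun := fun d => ⟨_, d.2⟩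
        invFun := fun h => ⟨⟨y * h.1⁻¹, aux_right H hy (by simp)⟩, by simp⟩
        left_inv := fun d => by ext; simp
        right_inv := fun d => by ext; simp }

theorem aux_disj {G : Type*} [Group G] (H : Subgroup G) (x : G)
    (h1 : doubleCoset H x ≠ doubleCoset H x⁻¹) {y : G} (h : y ∈ doubleCoset H x)
    (h' : y⁻¹ ∈ doubleCoset H x) : False := by
  apply h1
  apply DoubleCoset.eq_of_not_disjoint
  rw [Set.not_disjoint_iff]
  exact ⟨y, h, (aux_inv H).2 h'⟩

theorem statement_13 {G : Type*} [Group G] [Fintype G] (H : Subgroup G)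
    (hH : H ≠ ⊥) (x : G)
    (h1 : doubleCoset H x ≠ doubleCoset H x⁻¹)
    (h2 : (doubleCoset H x).ncard / Nat.card H = 1 ∨
      (doubleCoset H x).ncard / Nat.card H = 2) :
    (∃ R : Fin (Nat.card H) → Set G,
      (∀ i, IsRightTransversalIn H (doubleCoset H x ∪ doubleCoset H x⁻¹) (R i)) ∧
      (∀ i, R i = (R i)⁻¹) ∧
      (∀ i j, i ≠ j → Disjoint (R i) (R j))) ∧
    ∀ b : ℕ, b ≤ Nat.card H →
      ∃ R : Fin b → Set G,
        (∀ i, IsRightTransversalIn H (doubleCoset H x ∪ doubleCoset H x⁻¹) (R i)) ∧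
        (∀ i j, i ≠ j → Disjoint (R i) (R j)) ∧
        (⋃ i, R i) = (⋃ i, R i)⁻¹ := by
  obtain ⟨c, hc1, hc2⟩ := aux_mid H x
  have main : ∃ R : Fin (Nat.card H) → Set G,
      (∀ i, IsRightTransversalIn H (doubleCoset H x ∪ doubleCoset H x⁻¹) (R i)) ∧
      (∀ i, R i = (R i)⁻¹) ∧
      (∀ i j, i ≠ j → Disjoint (R i) (R j)) := by
    refine ⟨fun i => {t | (t ∈ doubleCoset H x ∧ c t = i) ∨
      (t⁻¹ ∈ doubleCoset H x ∧ c t⁻¹ = i)}, ?_, ?_, ?_⟩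
    · intro i
      refine ⟨?_, ?_⟩
      · rintro t (⟨h, -⟩ | ⟨h, -⟩)
        · exact Or.inl h
        · exact Or.inr ((aux_inv H).2 h)
      · rintro y (hy | hy)
        · obtain ⟨t, ⟨ht1, ht2⟩, ht3⟩ := hc1 y hy i
          refine ⟨t, ⟨Or.inl ⟨aux_left H hy ht1, ht2⟩, ht1⟩, ?_⟩
          rintro s ⟨⟨hs1, hs2⟩ | ⟨hs1, hs2⟩, hs3⟩
          · exact ht3 s ⟨hs3, hs2⟩
          · exact (aux_disj H x h1 (aux_left H hy hs3) hs1).elim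
        · have hy' := (aux_inv H).1 hy
          obtain ⟨t, ⟨ht1, ht2⟩, ht3⟩ := hc2 y⁻¹ hy' i
          refine ⟨t⁻¹, ⟨Or.inr (by simpa using ⟨aux_right H hy' ht1, ht2⟩), ht1⟩, ?_⟩
          rintro s ⟨⟨hs1, hs2⟩ | ⟨hs1, hs2⟩, hs3⟩
          · exact (aux_disj H x h1 hs1 (aux_right H hy' (by simpa using hs3))).elim
          · rw [← ht3 s⁻¹ ⟨by simpa using hs3, hs2⟩, inv_inv]
    · intro i
      ext t
      simp only [Set.mem_inv, Set.mem_ofPred_eq, inv_inv]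
      exact or_comm
    · intro i j hij
      rw [Set.disjoint_left]
      rintro t (⟨h, h'⟩ | ⟨h, h'⟩) (⟨k, k'⟩ | ⟨k, k'⟩)
      · exact hij (h'.symm.trans k')
      · exact aux_disj H x h1 h k
      · exact aux_disj H x h1 k h
      · exact hij (h'.symm.trans k')
  refine ⟨main, ?_⟩
  intro b hb
  obtain ⟨R, hR1, hR2, hR3⟩ := main
  refine ⟨fun i => R (Fin.castLE hb i), fun i => hR1 _, fun i j hij => hR3 _ _ ?_, ?_⟩
  · exact fun h => hij (Fin.castLE_injective hb h)
  · rw [Set.iUnion_inv]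
    exact Set.iUnion_congr fun i => hR2 _
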